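/- For every even integer n ≥ 2, the number b_n of bent functions in n variables satisfies b_n ≥ 2^{2^{n/2}} · (2^{n/2})!. -/

import Mathlib

/-- `𝔽₂ⁿ`, the space of binary vectors of length `n`. -/
abbrev BV (n : ℕ) : Type := Fin n → ZMod 2

/-- The inner product `⟨x, y⟩ = ⊕ᵢ xᵢ yᵢ` on `𝔽₂ⁿ`. -/
def ip {n : ℕ} (x y : BV n) : ZMod 2 := ∑ i, x i * y i

/-- The Walsh transform `W_f(y) = ∑_{x} (−1)^{f(x) ⊕ ⟨x,y⟩}` of a Boolean function. -/
def walsh {n : ℕ} (f : BV n → ZMod 2) (y : BV n) : ℤ :=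
  ∑ x : BV n, (-1 : ℤ) ^ ((f x + ip x y).val)

/-- A Boolean function in `n` variables (`n` even) is bent if `|W_f(y)| = 2^{n/2}`
for all `y`. -/
def IsBent (n : ℕ) (f : BV n → ZMod 2) : Prop :=
  ∀ y : BV n, |walsh f y| = 2 ^ (n / 2)

/-- `b_n`, the number of bent functions in `n` variables. -/
noncomputable def bentCount (n : ℕ) : ℕ :=
  Nat.card {f : BV n → ZMod 2 // IsBent n f}

/-- The sign `(−1)^c` of a bit is multiplicative. -/
lemma neg_one_pow_val_add (a b : ZMod 2) :
    (-1 : ℤ) ^ (a + b).val = (-1) ^ a.val * (-1) ^ b.val := by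
  revert a b; decide

lemma ip_add_left {n : ℕ} (x y z : BV n) : ip (x + y) z = ip x z + ip y z := by
  simp [ip, add_mul, Finset.sum_add_distrib]

lemma ip_add_right {n : ℕ} (x y z : BV n) : ip x (y + z) = ip x y + ip x z := by
  simp [ip, mul_add, Finset.sum_add_distrib]

lemma ip_append {m n : ℕ} (x y : BV m) (z w : BV n) :
    ip (Fin.append x z) (Fin.append y w) = ip x y + ip z w := by
  simp [ip, Fin.sum_univ_add]

/-- Orthogonality of the characters of `𝔽₂ⁿ`. -/
lemma sum_neg_one_pow_ip {n : ℕ} (a : BV n) :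
    ∑ x : BV n, (-1 : ℤ) ^ (ip x a).val = if a = 0 then 2 ^ n else 0 := by
  split_ifs with h
  · subst h
    simp [ip]
  · obtain ⟨i, hi⟩ := Function.ne_iff.mp h
    have hi1 : a i = 1 := Fin.eq_one_of_ne_zero _ hi
    have key : ∑ x : BV n, (-1 : ℤ) ^ (ip x a).val
        = ∑ x : BV n, -(-1 : ℤ) ^ (ip x a).val := by
      rw [← Equiv.sum_comp (Equiv.addRight (Pi.single i 1 : BV n))]
      refine Finset.sum_congr rfl fun x _ => ?_
      have h1 : ip (Pi.single i 1) a = 1 := by simp [ip, Pi.single_apply, hi1]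
      rw [Equiv.coe_addRight, ip_add_left, neg_one_pow_val_add, h1]
      simp [ZMod.val_one]
    rw [Finset.sum_neg_distrib] at key
    lia

/-- The Maiorana–McFarland function `(x, z) ↦ ⟨x, π(z)⟩ ⊕ g(z)`. -/
def maioranaMcFarland {m k : ℕ} (π : BV k → BV m) (g : BV k → ZMod 2) : BV (m + k) → ZMod 2 :=
  fun w => ip (fun i => w (Fin.castAdd k i)) (π fun i => w (Fin.natAdd m i)) +
    g fun i => w (Fin.natAdd m i)

lemma maioranaMcFarland_append {m k : ℕ} (π : BV k → BV m) (g : BV k → ZMod 2)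
    (x : BV m) (z : BV k) :
    maioranaMcFarland π g (Fin.append x z) = ip x (π z) + g z := by
  simp [maioranaMcFarland]

lemma walsh_maioranaMcFarland {m : ℕ} (π : Equiv.Perm (BV m)) (g : BV m → ZMod 2) (a b : BV m) :
    walsh (maioranaMcFarland π g) (Fin.append a b) =
      (-1) ^ (g (π.symm a) + ip (π.symm a) b).val * 2 ^ m := by
  have inner (z : BV m) :
      ∑ x : BV m, (-1 : ℤ) ^ (maioranaMcFarland π g (Fin.append x z) +
        ip (Fin.append x z) (Fin.append a b)).val =
      if z = π.symm a then (-1) ^ (g z + ip z b).val * 2 ^ m else 0 := by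
    have hz : π z + a = 0 ↔ z = π.symm a := by
      simp [Equiv.eq_symm_apply, funext_iff, CharTwo.add_eq_zero]
    rw [← mul_ite_zero, ← if_congr hz rfl rfl, ← sum_neg_one_pow_ip, Finset.mul_sum]
    refine Finset.sum_congr rfl fun x _ => ?_
    rw [maioranaMcFarland_append, ip_append, ← neg_one_pow_val_add, ip_add_right]
    congr 2
    ring
  rw [walsh, ← Equiv.sum_comp (Fin.appendEquiv m m), Fintype.sum_prod_type_right]
  simp only [Fin.appendEquiv, Equiv.coe_fn_mk, inner]
  simp

lemma isBent_maioranaMcFarland {m : ℕ} (π : Equiv.Perm (BV m)) (g : BV m → ZMod 2) :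
    IsBent (m + m) (maioranaMcFarland π g) := by
  intro y
  obtain ⟨⟨a, b⟩, rfl⟩ := (Fin.appendEquiv m m).surjective y
  have hm : (m + m) / 2 = m := by lia
  simp [Fin.appendEquiv, walsh_maioranaMcFarland, abs_mul, hm]

lemma maioranaMcFarland_injective {m : ℕ} :
    Function.Injective fun p : Equiv.Perm (BV m) × (BV m → ZMod 2) =>
      maioranaMcFarland p.1 p.2 := by
  rintro ⟨π, g⟩ ⟨ρ, h⟩ heq
  have happ (x z : BV m) : ip x (π z) + g z = ip x (ρ z) + h z := by
    simpa only [maioranaMcFarland_append] using congrFun heq (Fin.append x z)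
  have hg : g = h := by
    ext1 z
    simpa [ip] using happ 0 z
  subst hg
  have hπ : π = ρ := by
    ext z i
    simpa [ip, Pi.single_apply] using happ (Pi.single i 1) z
  rw [hπ]

/-- for every even `n ≥ 2`, `b_n ≥ 2^{2^{n/2}} · (2^{n/2})!`. -/
theorem stmt_15 (n : ℕ) (hn : Even n) (h2 : 2 ≤ n) :
    2 ^ (2 ^ (n / 2)) * Nat.factorial (2 ^ (n / 2)) ≤ bentCount n := by
  obtain ⟨m, rfl⟩ := hn
  have hm : (m + m) / 2 = m := by lia
  have hcard : Nat.card (Equiv.Perm (BV m) × (BV m → ZMod 2)) =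
      2 ^ (2 ^ m) * Nat.factorial (2 ^ m) := by
    simp [Nat.card_eq_fintype_card, Fintype.card_perm, mul_comm]
  rw [hm, ← hcard, bentCount]
  exact Nat.card_le_card_of_injective
    (fun p => ⟨maioranaMcFarland p.1 p.2, isBent_maioranaMcFarland p.1 p.2⟩)
    fun p q hpq => maioranaMcFarland_injective (congrArg Subtype.val hpq)
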